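/- Let $n\ge 2$, $0<\lambda<n$, $\alpha<1$, $\beta<n/q$, $\alpha+\beta>0$, $1\le q<\infty$ with $1/q = 1+(\alpha+\beta-\lambda)/n$, and let $K$ satisfy $|K(x)|\le C_0|x|^{\lambda-n}$ for $x\neq 0$ and $|K(x-y)-K(x)|\le C_0|y|/|x|^{n+1-\lambda}$ for $|y|\le|x|/2$. Then there is a constant $C$ such that for every divergence-free $\mathbf{f}\in L^1(\mathbb{R}^n,\mathbb{R}^n)$ with $\||x|^{\alpha}\mathbf{f}\|_{L^1}<\infty$, $\left\||x|^{-\beta}\,(K*\mathbf{f})\right\|_{L^q} \le C\,\||x|^{\alpha}\mathbf{f}\|_{L^1}$, where $K*\mathbf{f}$ acts componentwise. -/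

import Mathlib

open MeasureTheory

theorem pow_finrank_sub_one_mul_rpow (E : Type*) [NormedAddCommGroup E] [NormedSpace ℝ E]
    [FiniteDimensional ℝ E] [Nontrivial E] {s t : ℝ} (ht : 0 < t) :
    t ^ (Module.finrank ℝ E - 1) * t ^ s = t ^ ((Module.finrank ℝ E : ℝ) + s - 1) := by
  have hd : 1 ≤ Module.finrank ℝ E := Module.finrank_pos
  rw [← Real.rpow_natCast, ← Real.rpow_add ht, Nat.cast_sub hd]
  congr 1
  push_cast
  ring

section RadialIntegrals

variable {E : Type*} [NormedAddCommGroup E] [NormedSpace ℝ E] [FiniteDimensional ℝ E]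
  [Nontrivial E] [MeasurableSpace E] [BorelSpace E] (μ : Measure E) [μ.IsAddHaarMeasure]

/-- Power weights above the critical exponent are integrable on balls, with the right scaling. -/
theorem exists_lintegral_norm_rpow_ball_le {s : ℝ} (hs : -(Module.finrank ℝ E : ℝ) < s) :
    ∃ C : ℝ, ∀ R : ℝ, 0 < R →
      ∫⁻ x : E, ENNReal.ofReal (if ‖x‖ ≤ R then ‖x‖ ^ s else 0) ∂μ ≤
        ENNReal.ofReal (C * R ^ ((Module.finrank ℝ E : ℝ) + s)) := by
  refine ⟨Module.finrank ℝ E * (μ.real (Metric.ball 0 1) * (1 / (Module.finrank ℝ E + s))),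
    fun R hR => ?_⟩
  have heq : Set.EqOn (fun t : ℝ => t ^ (Module.finrank ℝ E - 1) • (if t ≤ R then t ^ s else 0))
      ((Set.Ioc 0 R).indicator fun t => t ^ ((Module.finrank ℝ E : ℝ) + s - 1)) (Set.Ioi 0) := by
    intro t (ht : 0 < t)
    by_cases h : t ≤ R
    · simp [h, ht, pow_finrank_sub_one_mul_rpow E ht]
    · simp [h]
  have hii : IntervalIntegrable (fun t : ℝ => t ^ ((Module.finrank ℝ E : ℝ) + s - 1)) volume 0 R :=
    intervalIntegral.intervalIntegrable_rpow' (by linarith)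
  have hint : Integrable (fun x : E => if ‖x‖ ≤ R then ‖x‖ ^ s else 0) μ := by
    rw [integrable_fun_norm_addHaar μ (f := fun t => if t ≤ R then t ^ s else 0),
      integrableOn_congr_fun heq measurableSet_Ioi]
    exact ((integrable_indicator_iff measurableSet_Ioc).2
      ((intervalIntegrable_iff_integrableOn_Ioc_of_le hR.le).1 hii)).integrableOn
  rw [← ofReal_integral_eq_lintegral_ofReal hint
    (Filter.Eventually.of_forall fun x => by
      change (0 : ℝ) ≤ ite _ _ _
      split_ifs <;> positivity),
    integral_fun_norm_addHaar μ (fun t => if t ≤ R then t ^ s else 0),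
    setIntegral_congr_fun measurableSet_Ioi heq, setIntegral_indicator measurableSet_Ioc,
    Set.inter_eq_right.2 Set.Ioc_subset_Ioi_self, ← intervalIntegral.integral_of_le hR.le,
    integral_rpow (Or.inl (by linarith))]
  refine ENNReal.ofReal_le_ofReal (le_of_eq ?_)
  rw [sub_add_cancel, Real.zero_rpow (by linarith)]
  simp only [smul_eq_mul, nsmul_eq_mul]
  ring

/-- Power weights below the critical exponent are integrable off balls, with the right scaling. -/
theorem exists_lintegral_norm_rpow_compl_ball_le {s : ℝ} (hs : s < -(Module.finrank ℝ E : ℝ)) :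
    ∃ C : ℝ, ∀ R : ℝ, 0 < R →
      ∫⁻ x : E, ENNReal.ofReal (if R ≤ ‖x‖ then ‖x‖ ^ s else 0) ∂μ ≤
        ENNReal.ofReal (C * R ^ ((Module.finrank ℝ E : ℝ) + s)) := by
  refine ⟨Module.finrank ℝ E * (μ.real (Metric.ball 0 1) * (-1 / (Module.finrank ℝ E + s))),
    fun R hR => ?_⟩
  have heq : Set.EqOn (fun t : ℝ => t ^ (Module.finrank ℝ E - 1) • (if R ≤ t then t ^ s else 0))
      ((Set.Ici R).indicator fun t => t ^ ((Module.finrank ℝ E : ℝ) + s - 1)) (Set.Ioi 0) := by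
    intro t (ht : 0 < t)
    by_cases h : R ≤ t
    · simp [h, pow_finrank_sub_one_mul_rpow E ht]
    · simp [h]
  have hint : Integrable (fun x : E => if R ≤ ‖x‖ then ‖x‖ ^ s else 0) μ := by
    rw [integrable_fun_norm_addHaar μ (f := fun t => if R ≤ t then t ^ s else 0),
      integrableOn_congr_fun heq measurableSet_Ioi]
    exact ((integrable_indicator_iff measurableSet_Ici).2
      ((integrableOn_Ici_iff_integrableOn_Ioi (by simp)).2
        (integrableOn_Ioi_rpow_of_lt (by linarith) hR))).integrableOn
  rw [← ofReal_integral_eq_lintegral_ofReal hint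
    (Filter.Eventually.of_forall fun x => by
      change (0 : ℝ) ≤ ite _ _ _
      split_ifs <;> positivity),
    integral_fun_norm_addHaar μ (fun t => if R ≤ t then t ^ s else 0),
    setIntegral_congr_fun measurableSet_Ioi heq, setIntegral_indicator measurableSet_Ici,
    Set.inter_eq_right.2 (Set.Ici_subset_Ioi.2 hR), integral_Ici_eq_integral_Ioi,
    integral_Ioi_rpow_of_lt (by linarith) hR]
  refine ENNReal.ofReal_le_ofReal (le_of_eq ?_)
  rw [sub_add_cancel]
  simp only [smul_eq_mul, nsmul_eq_mul]
  ring

/-- A homogeneous kernel of critical degree supported in `‖x‖ ≤ c‖y‖` is uniformly in `L^q`. -/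
theorem exists_lintegral_kernel_ball_le {a b q c : ℝ} (hq : 0 < q) (hc : 0 < c)
    (ha : -(Module.finrank ℝ E : ℝ) < a * q) (hab : (a + b) * q = -(Module.finrank ℝ E : ℝ)) :
    ∃ B : ℝ, ∀ y : E, y ≠ 0 →
      ∫⁻ x : E, ENNReal.ofReal (if ‖x‖ ≤ c * ‖y‖ then ‖x‖ ^ a * ‖y‖ ^ b else 0) ^ q ∂μ ≤
        ENNReal.ofReal B := by
  obtain ⟨C, hC⟩ := exists_lintegral_norm_rpow_ball_le μ ha
  refine ⟨C * c ^ ((Module.finrank ℝ E : ℝ) + a * q), fun y hy => ?_⟩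
  have hy' : 0 < ‖y‖ := norm_pos_iff.2 hy
  have h1 : ∀ x : E, ENNReal.ofReal (if ‖x‖ ≤ c * ‖y‖ then ‖x‖ ^ a * ‖y‖ ^ b else 0) ^ q =
      ENNReal.ofReal (‖y‖ ^ (b * q)) *
        ENNReal.ofReal (if ‖x‖ ≤ c * ‖y‖ then ‖x‖ ^ (a * q) else 0) := by
    intro x
    rw [← ENNReal.ofReal_mul (by positivity),
      ENNReal.ofReal_rpow_of_nonneg (by split_ifs <;> positivity) hq.le]
    congr 1
    split_ifs
    · rw [Real.mul_rpow (by positivity) (by positivity), ← Real.rpow_mul (norm_nonneg _),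
        ← Real.rpow_mul (norm_nonneg _), mul_comm]
    · simp [Real.zero_rpow hq.ne']
  simp_rw [h1]
  rw [lintegral_const_mul' _ _ ENNReal.ofReal_ne_top]
  refine (mul_le_mul_right (hC _ (mul_pos hc hy')) _).trans ?_
  rw [← ENNReal.ofReal_mul (by positivity)]
  refine ENNReal.ofReal_le_ofReal (le_of_eq ?_)
  rw [Real.mul_rpow hc.le hy'.le]
  have : ‖y‖ ^ (b * q) * ‖y‖ ^ ((Module.finrank ℝ E : ℝ) + a * q) = 1 := by
    rw [← Real.rpow_add hy', show b * q + ((Module.finrank ℝ E : ℝ) + a * q) = 0 by linarith,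
      Real.rpow_zero]
  linear_combination C * c ^ ((Module.finrank ℝ E : ℝ) + a * q) * this

/-- A homogeneous kernel of critical degree supported in `c‖y‖ ≤ ‖x‖` is uniformly in `L^q`. -/
theorem exists_lintegral_kernel_compl_ball_le {a b q c : ℝ} (hq : 0 < q) (hc : 0 < c)
    (ha : a * q < -(Module.finrank ℝ E : ℝ)) (hab : (a + b) * q = -(Module.finrank ℝ E : ℝ)) :
    ∃ B : ℝ, ∀ y : E, y ≠ 0 →
      ∫⁻ x : E, ENNReal.ofReal (if c * ‖y‖ ≤ ‖x‖ then ‖x‖ ^ a * ‖y‖ ^ b else 0) ^ q ∂μ ≤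
        ENNReal.ofReal B := by
  obtain ⟨C, hC⟩ := exists_lintegral_norm_rpow_compl_ball_le μ ha
  refine ⟨C * c ^ ((Module.finrank ℝ E : ℝ) + a * q), fun y hy => ?_⟩
  have hy' : 0 < ‖y‖ := norm_pos_iff.2 hy
  have h1 : ∀ x : E, ENNReal.ofReal (if c * ‖y‖ ≤ ‖x‖ then ‖x‖ ^ a * ‖y‖ ^ b else 0) ^ q =
      ENNReal.ofReal (‖y‖ ^ (b * q)) *
        ENNReal.ofReal (if c * ‖y‖ ≤ ‖x‖ then ‖x‖ ^ (a * q) else 0) := by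
    intro x
    rw [← ENNReal.ofReal_mul (by positivity),
      ENNReal.ofReal_rpow_of_nonneg (by split_ifs <;> positivity) hq.le]
    congr 1
    split_ifs
    · rw [Real.mul_rpow (by positivity) (by positivity), ← Real.rpow_mul (norm_nonneg _),
        ← Real.rpow_mul (norm_nonneg _), mul_comm]
    · simp [Real.zero_rpow hq.ne']
  simp_rw [h1]
  rw [lintegral_const_mul' _ _ ENNReal.ofReal_ne_top]
  refine (mul_le_mul_right (hC _ (mul_pos hc hy')) _).trans ?_
  rw [← ENNReal.ofReal_mul (by positivity)]
  refine ENNReal.ofReal_le_ofReal (le_of_eq ?_)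
  rw [Real.mul_rpow hc.le hy'.le]
  have : ‖y‖ ^ (b * q) * ‖y‖ ^ ((Module.finrank ℝ E : ℝ) + a * q) = 1 := by
    rw [← Real.rpow_add hy', show b * q + ((Module.finrank ℝ E : ℝ) + a * q) = 0 by linarith,
      Real.rpow_zero]
  linear_combination C * c ^ ((Module.finrank ℝ E : ℝ) + a * q) * this

end RadialIntegrals

/-- An integral operator whose kernel is uniformly in `L^q` in the first variable maps
`L^1` to `L^q`. -/
theorem lintegral_rpow_lintegral_kernel_le {X Y : Type*} [MeasurableSpace X] [MeasurableSpace Y]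
    {μ : Measure X} {ν : Measure Y} [SFinite μ] [SFinite ν] {q : ℝ} (hq : 1 ≤ q)
    {k : X → Y → ENNReal} (hk : Measurable (Function.uncurry k)) {w : Y → ENNReal}
    (hw : AEMeasurable w ν) {B : ENNReal} (hB : ∀ᵐ y ∂ν, ∫⁻ x, k x y ^ q ∂μ ≤ B) :
    (∫⁻ x, (∫⁻ y, k x y * w y ∂ν) ^ q ∂μ) ^ (1 / q) ≤ B ^ (1 / q) * ∫⁻ y, w y ∂ν := by
  have hq0 : 0 < q := by linarith
  set M := ∫⁻ y, w y ∂ν with hM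
  have hkx : ∀ x, Measurable (k x) := fun x => hk.of_uncurry_left
  have holder : ∀ x, (∫⁻ y, k x y * w y ∂ν) ^ q ≤ (∫⁻ y, w y * k x y ^ q ∂ν) * M ^ (q - 1) := by
    intro x
    have h := eLpNorm'_le_eLpNorm'_mul_rpow_measure_univ (μ := ν.withDensity w) one_pos hq
      (hkx x).aestronglyMeasurable
    simp only [eLpNorm'_eq_lintegral_enorm, enorm_eq_self, ENNReal.rpow_one, div_one,
      withDensity_apply _ MeasurableSet.univ, Measure.restrict_univ] at h
    rw [lintegral_withDensity_eq_lintegral_mul₀ hw (hkx x).aemeasurable,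
      lintegral_withDensity_eq_lintegral_mul₀ hw ((hkx x).pow_const q).aemeasurable] at h
    simp only [Pi.mul_apply] at h
    calc (∫⁻ y, k x y * w y ∂ν) ^ q = (∫⁻ y, w y * k x y ∂ν) ^ q := by simp_rw [mul_comm]
      _ ≤ ((∫⁻ y, w y * k x y ^ q ∂ν) ^ (1 / q) * M ^ (1 - 1 / q)) ^ q := by gcongr
      _ = _ := by
        rw [ENNReal.mul_rpow_of_nonneg _ _ hq0.le, ← ENNReal.rpow_mul, ← ENNReal.rpow_mul,
          one_div_mul_cancel hq0.ne', ENNReal.rpow_one, sub_mul, one_mul,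
          one_div_mul_cancel hq0.ne']
  have key : ∫⁻ x, (∫⁻ y, k x y * w y ∂ν) ^ q ∂μ ≤ B * M ^ q := by
    calc ∫⁻ x, (∫⁻ y, k x y * w y ∂ν) ^ q ∂μ
        ≤ ∫⁻ x, (∫⁻ y, w y * k x y ^ q ∂ν) * M ^ (q - 1) ∂μ := lintegral_mono holder
      _ = (∫⁻ x, ∫⁻ y, w y * k x y ^ q ∂ν ∂μ) * M ^ (q - 1) := by
        refine lintegral_mul_const'' _ ?_
        have : AEMeasurable (Function.uncurry fun x y => w y * k x y ^ q) (μ.prod ν) :=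
          hw.comp_snd.mul (hk.pow_const q).aemeasurable
        exact this.lintegral_prod_right'
      _ = (∫⁻ y, ∫⁻ x, w y * k x y ^ q ∂μ ∂ν) * M ^ (q - 1) := by
        rw [lintegral_lintegral_swap]
        exact hw.comp_snd.mul (hk.pow_const q).aemeasurable
      _ = (∫⁻ y, w y * ∫⁻ x, k x y ^ q ∂μ ∂ν) * M ^ (q - 1) := by
        congr 2
        funext y
        exact lintegral_const_mul _ (hk.of_uncurry_right.pow_const q)
      _ ≤ (∫⁻ y, w y * B ∂ν) * M ^ (q - 1) := by
        gcongr ?_ * _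
        refine lintegral_mono_ae ?_
        filter_upwards [hB] with y hy
        gcongr
      _ = B * (M ^ (1 : ℝ) * M ^ (q - 1)) := by
        rw [lintegral_mul_const'' _ hw, ENNReal.rpow_one]
        ring
      _ = B * M ^ q := by
        rw [← ENNReal.rpow_add_of_nonneg _ _ zero_le_one (by linarith), add_sub_cancel]
  calc _ ≤ (B * M ^ q) ^ (1 / q) := by gcongr
    _ = _ := by
      rw [ENNReal.mul_rpow_of_nonneg _ _ (by positivity), ← ENNReal.rpow_mul,
        mul_one_div_cancel hq0.ne', ENNReal.rpow_one]

/-- A smooth cutoff equal to one near the origin, which on a divergence-free field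
averages to something controlled by the first moment of the field. -/
theorem exists_cutoff_enorm_integral_le (n : ℕ) :
    ∃ χ : EuclideanSpace ℝ (Fin n) → ℝ, ∃ C : ℝ, 0 ≤ C ∧ Measurable χ ∧
      (∀ y, ‖y‖ ≤ 1 / 4 → χ y = 1) ∧ (∀ y, 1 / 2 < ‖y‖ → χ y = 0) ∧ (∀ y, |χ y| ≤ 1) ∧
      ∀ f : EuclideanSpace ℝ (Fin n) → EuclideanSpace ℝ (Fin n), Integrable f →
      (∀ φ : EuclideanSpace ℝ (Fin n) → ℝ, ContDiff ℝ (⊤ : ℕ∞) φ → HasCompactSupport φ →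
        ∫ y, ∑ i, f y i * fderiv ℝ φ y (EuclideanSpace.single i 1) = 0) →
      ∀ r : ℝ, 0 < r → ‖∫ y, χ (r⁻¹ • y) • f y‖ₑ ≤
        ∫⁻ y, ENNReal.ofReal (if 2 * ‖y‖ ≤ r then C * (‖y‖ / r) * ‖f y‖ else 0) := by
  let χ : ContDiffBump (0 : EuclideanSpace ℝ (Fin n)) := ⟨1 / 4, 1 / 2, by norm_num, by norm_num⟩
  have hχs : ContDiff ℝ (⊤ : ℕ∞) χ := χ.contDiff
  have hχd : Differentiable ℝ χ := hχs.differentiable (by simp)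
  have hχ' : Continuous (fderiv ℝ χ) := hχs.continuous_fderiv (by simp)
  obtain ⟨C, hC⟩ := (χ.hasCompactSupport.fderiv (𝕜 := ℝ)).exists_bound_of_continuous hχ'
  have hsupp : ∀ y, 1 / 2 < ‖y‖ → fderiv ℝ χ y = 0 := by
    intro y hy
    by_contra h
    have := support_fderiv_subset ℝ (Function.mem_support.2 h)
    rw [χ.tsupport_eq, mem_closedBall_zero_iff] at this
    exact absurd this (not_le.2 hy)
  refine ⟨χ, C, (norm_nonneg _).trans (hC 0), χ.continuous.measurable, fun y hy => ?_,
    fun y hy => ?_, fun y => ?_, fun f hf hdiv r hr => ?_⟩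
  · exact χ.one_of_mem_closedBall (mem_closedBall_zero_iff.2 hy)
  · exact χ.zero_of_le_dist (by simpa [χ] using hy.le)
  · rw [abs_of_nonneg χ.nonneg]
    exact χ.le_one
  have hderiv : ∀ y, HasFDerivAt (fun z => χ (r⁻¹ • z)) (r⁻¹ • fderiv ℝ χ (r⁻¹ • y)) y := by
    intro y
    have h := (hχd (r⁻¹ • y)).hasFDerivAt.comp y
      ((ContinuousLinearMap.id ℝ (EuclideanSpace ℝ (Fin n))).hasFDerivAt.const_smul r⁻¹)
    have he : fderiv ℝ χ (r⁻¹ • y) ∘L (r⁻¹ • ContinuousLinearMap.id ℝ (EuclideanSpace ℝ (Fin n))) =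
        r⁻¹ • fderiv ℝ χ (r⁻¹ • y) := by
      ext v
      simp
    exact he ▸ h
  have hnorm : ∀ y : EuclideanSpace ℝ (Fin n), ‖r⁻¹ • y‖ = ‖y‖ / r := by
    intro y
    rw [norm_smul, Real.norm_of_nonneg (by positivity), inv_mul_eq_div]
  set g : EuclideanSpace ℝ (Fin n) → EuclideanSpace ℝ (Fin n) :=
    fun y => (r⁻¹ * fderiv ℝ χ (r⁻¹ • y) (f y)) • y with hg
  have hbound : ∀ y, ‖g y‖ ≤ if 2 * ‖y‖ ≤ r then C * (‖y‖ / r) * ‖f y‖ else 0 := by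
    intro y
    split_ifs with h
    · rw [hg, norm_smul, norm_mul, Real.norm_of_nonneg (by positivity : 0 ≤ r⁻¹)]
      have := ((fderiv ℝ χ (r⁻¹ • y)).le_opNorm (f y)).trans
        (mul_le_mul_of_nonneg_right (hC (r⁻¹ • y)) (norm_nonneg _))
      calc _ ≤ r⁻¹ * (C * ‖f y‖) * ‖y‖ := by gcongr
        _ = _ := by field_simp
    · have h0 : fderiv ℝ χ (r⁻¹ • y) = 0 := hsupp _ (by
        rw [hnorm, lt_div_iff₀ hr]
        linarith [not_le.1 h])
      simp [hg, h0]
  have hχf : Integrable (fun y => χ (r⁻¹ • y) • f y) := by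
    refine hf.bdd_smul 1 (χ.continuous.comp (continuous_const_smul _)).aestronglyMeasurable ?_
    refine Filter.Eventually.of_forall fun y => ?_
    exact (Real.norm_of_nonneg χ.nonneg).trans_le χ.le_one
  have hgi : Integrable g := by
    refine (hf.norm.const_mul C).mono' ?_ (Filter.Eventually.of_forall fun y => ?_)
    · refine AEStronglyMeasurable.fun_smul (AEStronglyMeasurable.const_mul ?_ _)
        continuous_id.aestronglyMeasurable
      have hc : Continuous fun p : (EuclideanSpace ℝ (Fin n) →L[ℝ] ℝ) × EuclideanSpace ℝ (Fin n) =>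
        p.1 p.2 := by fun_prop
      exact hc.comp_aestronglyMeasurable
        ((hχ'.comp (continuous_const_smul r⁻¹)).aestronglyMeasurable.prodMk hf.1)
    · refine (hbound y).trans ?_
      have hC0 := (norm_nonneg _).trans (hC 0)
      split_ifs with h
      · have : ‖y‖ / r ≤ 1 := by
          rw [div_le_one hr]
          linarith [norm_nonneg y]
        gcongr
        nlinarith
      · positivity
  have hsum : ∫ y, (χ (r⁻¹ • y) • f y + g y) = 0 := by
    ext i
    have hcoord : (∫ y, (χ (r⁻¹ • y) • f y + g y)) i =
        ∫ y, (χ (r⁻¹ • y) • f y + g y) i :=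
      ((EuclideanSpace.proj i :
        EuclideanSpace ℝ (Fin n) →L[ℝ] ℝ).integral_comp_comm (hχf.add hgi)).symm
    have hφ : ∀ y, HasFDerivAt (fun z : EuclideanSpace ℝ (Fin n) => z i * χ (r⁻¹ • z))
        (y i • r⁻¹ • fderiv ℝ χ (r⁻¹ • y) + χ (r⁻¹ • y) • EuclideanSpace.proj i) y := fun y =>
      (EuclideanSpace.proj i : EuclideanSpace ℝ (Fin n) →L[ℝ] ℝ).hasFDerivAt.mul (hderiv y)
    rw [hcoord]
    refine Eq.trans ?_ (hdiv (fun z => z i * χ (r⁻¹ • z)) ?_ ?_)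
    · congr 1
      funext y
      have hfy : f y = ∑ j, f y j • EuclideanSpace.single j (1 : ℝ) := by
        ext k
        simp [Finset.sum_apply, Pi.single_apply]
      have hL : ∀ L : EuclideanSpace ℝ (Fin n) →L[ℝ] ℝ,
          ∑ j, f y j * L (EuclideanSpace.single j 1) = L (f y) := by
        intro L
        conv_rhs => rw [hfy, map_sum]
        simp
      rw [hL, (hφ y).fderiv]
      simp [hg]
      ring
    · exact (EuclideanSpace.proj i : EuclideanSpace ℝ (Fin n) →L[ℝ] ℝ).contDiff.mul
        (hχs.comp (contDiff_const_smul _))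
    · exact (χ.hasCompactSupport.comp_smul (inv_ne_zero hr.ne')).mul_left
  rw [integral_add hχf hgi] at hsum
  rw [eq_neg_of_add_eq_zero_left hsum, enorm_neg]
  refine (enorm_integral_le_lintegral_enorm _).trans (lintegral_mono fun y => ?_)
  rw [← ofReal_norm]
  exact ENNReal.ofReal_le_ofReal (hbound y)

/-- The size of the part of the weighted kernel acting on `‖y‖ ^ α * ‖f y‖`, split according to
whether `x` is close to the origin, close to `y`, or far away. -/
noncomputable def weightedKernel {n : ℕ} (lam α β : ℝ) (x y : EuclideanSpace ℝ (Fin n)) : ℝ :=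
  (if ‖x‖ ≤ 1 / 2 * ‖y‖ then ‖x‖ ^ (-β) * ‖y‖ ^ (lam - n - α) else 0) +
  (if ‖x - y‖ ≤ 5 * ‖y‖ then ‖x - y‖ ^ (lam - n) * ‖y‖ ^ (-β - α) else 0) +
  (if 2 * ‖y‖ ≤ ‖x‖ then ‖x‖ ^ (lam - n - 1 - β) * ‖y‖ ^ (1 - α) else 0)

theorem measurable_weightedKernel {n : ℕ} (lam α β : ℝ) :
    Measurable (Function.uncurry (weightedKernel (n := n) lam α β)) := by
  unfold weightedKernel Function.uncurry
  refine (Measurable.add (Measurable.add ?_ ?_) ?_) <;>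
  refine Measurable.ite (measurableSet_le ?_ ?_) ?_ measurable_const <;> fun_prop

theorem exists_lintegral_weightedKernel_le {n : ℕ} (hn : 2 ≤ n) {lam α β q : ℝ}
    (hα : α < 1) (hq1 : 1 ≤ q) (hβ : β < n / q) (hαβ : 0 < α + β)
    (hscal : 1 / q = 1 + (α + β - lam) / n) :
    ∃ B : ℝ, 0 ≤ B ∧ ∀ y : EuclideanSpace ℝ (Fin n), y ≠ 0 →
      ∫⁻ x, ENNReal.ofReal (weightedKernel lam α β x y) ^ q ≤ ENNReal.ofReal B := by
  have hq : 0 < q := by linarith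
  have hn0 : (0 : ℝ) < n := by positivity
  have hN : (n : ℝ) = (n + α + β - lam) * q := by
    field_simp at hscal
    linarith
  have hβ' : β * q < n := (lt_div_iff₀ hq).1 hβ
  have : Nonempty (Fin n) := ⟨⟨0, by omega⟩⟩
  have hfr : (Module.finrank ℝ (EuclideanSpace ℝ (Fin n)) : ℝ) = n := by simp
  obtain ⟨B₁, hB₁⟩ := exists_lintegral_kernel_ball_le (E := EuclideanSpace ℝ (Fin n)) volume
    (a := -β) (b := lam - n - α) (c := 1 / 2) hq (by norm_num) (by rw [hfr]; linarith)
    (by rw [hfr]; linarith)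
  obtain ⟨B₂, hB₂⟩ := exists_lintegral_kernel_ball_le (E := EuclideanSpace ℝ (Fin n)) volume
    (a := lam - n) (b := -β - α) (c := 5) hq (by norm_num) (by rw [hfr]; nlinarith)
    (by rw [hfr]; linarith)
  obtain ⟨B₃, hB₃⟩ := exists_lintegral_kernel_compl_ball_le (E := EuclideanSpace ℝ (Fin n)) volume
    (a := lam - n - 1 - β) (b := 1 - α) (c := 2) hq (by norm_num) (by rw [hfr]; nlinarith)
    (by rw [hfr]; linarith)
  have hpow : ∀ a b : ENNReal, (a + b) ^ q ≤ 2 ^ (q - 1) * (a ^ q + b ^ q) := fun a b =>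
    ENNReal.rpow_add_le_mul_rpow_add_rpow a b hq1
  set c : ENNReal := 2 ^ (q - 1) with hc
  have hctop : c ≠ ⊤ := ENNReal.rpow_ne_top_of_nonneg (by linarith) (by simp)
  set T : ENNReal := c * (c * (ENNReal.ofReal B₁ + ENNReal.ofReal B₂) + ENNReal.ofReal B₃) with hT
  have hTtop : T ≠ ⊤ := by
    refine ENNReal.mul_ne_top hctop (ENNReal.add_ne_top.2 ⟨ENNReal.mul_ne_top hctop ?_, ?_⟩) <;>
    simp
  refine ⟨T.toReal, ENNReal.toReal_nonneg, fun y hy => ?_⟩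
  rw [ENNReal.ofReal_toReal hTtop]
  have hmeas : ∀ {p : EuclideanSpace ℝ (Fin n) → ℝ}, Measurable p →
      AEMeasurable (fun x => ENNReal.ofReal (p x) ^ q) volume := fun hp =>
    (hp.ennreal_ofReal.pow_const q).aemeasurable
  set k₁ := fun x : EuclideanSpace ℝ (Fin n) =>
    if ‖x‖ ≤ 1 / 2 * ‖y‖ then ‖x‖ ^ (-β) * ‖y‖ ^ (lam - n - α) else 0 with hk₁
  set k₂ := fun x : EuclideanSpace ℝ (Fin n) =>
    if ‖x - y‖ ≤ 5 * ‖y‖ then ‖x - y‖ ^ (lam - n) * ‖y‖ ^ (-β - α) else 0 with hk₂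
  set k₃ := fun x : EuclideanSpace ℝ (Fin n) =>
    if 2 * ‖y‖ ≤ ‖x‖ then ‖x‖ ^ (lam - n - 1 - β) * ‖y‖ ^ (1 - α) else 0 with hk₃
  have hm₁ : Measurable k₁ :=
    Measurable.ite (measurableSet_le (by fun_prop) (by fun_prop)) (by fun_prop) measurable_const
  have hm₂ : Measurable k₂ :=
    Measurable.ite (measurableSet_le (by fun_prop) (by fun_prop)) (by fun_prop) measurable_const
  have hm₁₂ : AEMeasurable (fun x => c * (ENNReal.ofReal (k₁ x) ^ q + ENNReal.ofReal (k₂ x) ^ q))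
      volume := ((hmeas hm₁).add (hmeas hm₂)).const_mul c
  have hI₂ : ∫⁻ x, ENNReal.ofReal (k₂ x) ^ q ≤ ENNReal.ofReal B₂ :=
    (lintegral_sub_right_eq_self (fun x : EuclideanSpace ℝ (Fin n) => ENNReal.ofReal
      (if ‖x‖ ≤ 5 * ‖y‖ then ‖x‖ ^ (lam - n) * ‖y‖ ^ (-β - α) else 0) ^ q) y).trans_le (hB₂ y hy)
  calc ∫⁻ x, ENNReal.ofReal (weightedKernel lam α β x y) ^ q
      ≤ ∫⁻ x, c * (c * (ENNReal.ofReal (k₁ x) ^ q + ENNReal.ofReal (k₂ x) ^ q) +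
          ENNReal.ofReal (k₃ x) ^ q) := by
        refine lintegral_mono fun x => ?_
        calc ENNReal.ofReal (k₁ x + k₂ x + k₃ x) ^ q
            ≤ (ENNReal.ofReal (k₁ x) + ENNReal.ofReal (k₂ x) + ENNReal.ofReal (k₃ x)) ^ q := by
              gcongr
              exact ENNReal.ofReal_add_le.trans (by gcongr; exact ENNReal.ofReal_add_le)
          _ ≤ c * ((ENNReal.ofReal (k₁ x) + ENNReal.ofReal (k₂ x)) ^ q +
                ENNReal.ofReal (k₃ x) ^ q) := hpow _ _
          _ ≤ _ := by
              gcongr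
              exact hpow _ _
    _ = c * (c * ((∫⁻ x, ENNReal.ofReal (k₁ x) ^ q) + ∫⁻ x, ENNReal.ofReal (k₂ x) ^ q) +
          ∫⁻ x, ENNReal.ofReal (k₃ x) ^ q) := by
        rw [lintegral_const_mul' _ _ hctop,
          lintegral_add_left' hm₁₂,
          lintegral_const_mul' _ _ hctop, lintegral_add_left' (hmeas hm₁)]
    _ ≤ T := by
        rw [hT]
        gcongr
        · exact hB₁ y hy
        · exact hB₃ y hy

/-- The size estimate for the kernel in the region where `x` is not much larger than `y`. -/
theorem norm_rpow_mul_norm_sub_rpow_le_weightedKernel {n : ℕ} {lam α β : ℝ} (hln : lam < n)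
    {x y : EuclideanSpace ℝ (Fin n)} (hx : x ≠ 0) (hy : y ≠ 0) (hxy : ‖x‖ ≤ 4 * ‖y‖) :
    ‖x‖ ^ (-β) * ‖x - y‖ ^ (lam - n) ≤
      (2 ^ (n - lam) + (2 ^ β + 4 ^ (-β))) * weightedKernel lam α β x y * ‖y‖ ^ α := by
  have ha : 0 < ‖x‖ := norm_pos_iff.2 hx
  have hb : 0 < ‖y‖ := norm_pos_iff.2 hy
  have hD : ‖y‖ - ‖x‖ ≤ ‖x - y‖ := by
    rw [norm_sub_rev]
    exact norm_sub_norm_le y x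
  have hD' : ‖x - y‖ ≤ ‖x‖ + ‖y‖ := norm_sub_le x y
  have hyα : ∀ s, ‖y‖ ^ (s - α) * ‖y‖ ^ α = ‖y‖ ^ s := fun s => by
    rw [← Real.rpow_add hb, sub_add_cancel]
  have hc : (0 : ℝ) < 2 ^ (n - lam) := by positivity
  have hc' : (0 : ℝ) < 2 ^ β + 4 ^ (-β) := by positivity
  by_cases h : ‖x‖ ≤ 1 / 2 * ‖y‖
  · have h1 : ‖x‖ ^ (-β) * ‖y‖ ^ (lam - n - α) ≤ weightedKernel lam α β x y := by
      unfold weightedKernel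
      rw [if_pos h, add_assoc]
      refine le_add_of_nonneg_right (add_nonneg ?_ ?_) <;> split_ifs <;> positivity
    have h2 : ‖x - y‖ ^ (lam - n) ≤ 2 ^ (n - lam) * ‖y‖ ^ (lam - n) := by
      calc ‖x - y‖ ^ (lam - n) ≤ (2⁻¹ * ‖y‖) ^ (lam - n) :=
            Real.rpow_le_rpow_of_nonpos (by positivity) (by linarith) (by linarith)
        _ = _ := by
            rw [Real.mul_rpow (by norm_num) hb.le, Real.inv_rpow (by norm_num),
              ← Real.rpow_neg (by norm_num), neg_sub]
    calc ‖x‖ ^ (-β) * ‖x - y‖ ^ (lam - n)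
        ≤ ‖x‖ ^ (-β) * (2 ^ (n - lam) * ‖y‖ ^ (lam - n)) := by gcongr
      _ = 2 ^ (n - lam) * (‖x‖ ^ (-β) * ‖y‖ ^ (lam - n - α)) * ‖y‖ ^ α := by
        rw [← hyα (lam - n)]
        ring
      _ ≤ _ := by
        gcongr
        linarith
  · have h1 : ‖x - y‖ ^ (lam - n) * ‖y‖ ^ (-β - α) ≤ weightedKernel lam α β x y := by
      unfold weightedKernel
      rw [if_neg h, if_pos (by linarith), zero_add]
      refine le_add_of_nonneg_right ?_
      split_ifs <;> positivity
    have h2 : ‖x‖ ^ (-β) ≤ (2 ^ β + 4 ^ (-β)) * ‖y‖ ^ (-β) := by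
      rw [add_mul]
      rcases le_total 0 β with hβ | hβ
      · refine le_add_of_le_of_nonneg ?_ (by positivity)
        calc ‖x‖ ^ (-β) ≤ (2⁻¹ * ‖y‖) ^ (-β) :=
              Real.rpow_le_rpow_of_nonpos (by positivity) (by linarith) (by linarith)
          _ = _ := by
              rw [Real.mul_rpow (by norm_num) hb.le, Real.inv_rpow (by norm_num),
                ← Real.rpow_neg (by norm_num), neg_neg]
      · refine le_add_of_nonneg_of_le (by positivity) ?_
        rw [← Real.mul_rpow (by norm_num) hb.le]
        exact Real.rpow_le_rpow ha.le hxy (by linarith)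
    calc ‖x‖ ^ (-β) * ‖x - y‖ ^ (lam - n)
        ≤ (2 ^ β + 4 ^ (-β)) * ‖y‖ ^ (-β) * ‖x - y‖ ^ (lam - n) := by gcongr
      _ = (2 ^ β + 4 ^ (-β)) * (‖x - y‖ ^ (lam - n) * ‖y‖ ^ (-β - α)) * ‖y‖ ^ α := by
        rw [← hyα (-β)]
        ring
      _ ≤ _ := by
        refine mul_le_mul_of_nonneg_right (mul_le_mul ?_ h1 ?_ ?_) ?_
        · linarith
        all_goals positivity

/-- The size estimate for the first-order Taylor remainder where `x` is far from `y`. -/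
theorem norm_rpow_mul_norm_le_weightedKernel {n : ℕ} {lam α β : ℝ}
    {x y : EuclideanSpace ℝ (Fin n)} (hy : y ≠ 0) (hxy : 2 * ‖y‖ ≤ ‖x‖) :
    ‖x‖ ^ (lam - n - 1 - β) * ‖y‖ ≤ weightedKernel lam α β x y * ‖y‖ ^ α := by
  have hb : 0 < ‖y‖ := norm_pos_iff.2 hy
  have h1 : ‖x‖ ^ (lam - n - 1 - β) * ‖y‖ ^ (1 - α) ≤ weightedKernel lam α β x y := by
    unfold weightedKernel
    rw [if_pos hxy]
    refine le_add_of_nonneg_left (add_nonneg ?_ ?_) <;> split_ifs <;> positivity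
  calc ‖x‖ ^ (lam - n - 1 - β) * ‖y‖ = ‖x‖ ^ (lam - n - 1 - β) * ‖y‖ ^ (1 - α) * ‖y‖ ^ α := by
        rw [mul_assoc, ← Real.rpow_add hb, sub_add_cancel, Real.rpow_one]
    _ ≤ _ := by gcongr

theorem weightedKernel_nonneg {n : ℕ} (lam α β : ℝ) (x y : EuclideanSpace ℝ (Fin n)) :
    0 ≤ weightedKernel lam α β x y := by
  unfold weightedKernel
  refine add_nonneg (add_nonneg ?_ ?_) ?_ <;> split_ifs <;> positivity

/-- Subtracting the cut-off value at `x` from the kernel leaves a remainder controlled by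
`weightedKernel`. -/
theorem norm_rpow_mul_abs_sub_cutoff_le {n : ℕ} {lam α β C₀ : ℝ} (hln : lam < n) (hC₀ : 0 < C₀)
    {K χ : EuclideanSpace ℝ (Fin n) → ℝ}
    (hK1 : ∀ x : EuclideanSpace ℝ (Fin n), x ≠ 0 → |K x| ≤ C₀ * ‖x‖ ^ (lam - n))
    (hK2 : ∀ x y : EuclideanSpace ℝ (Fin n), x ≠ 0 → ‖y‖ ≤ ‖x‖ / 2 →
      |K (x - y) - K x| ≤ C₀ * ‖y‖ / ‖x‖ ^ ((n : ℝ) + 1 - lam))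
    (hχ1 : ∀ y, ‖y‖ ≤ 1 / 4 → χ y = 1) (hχ0 : ∀ y, 1 / 2 < ‖y‖ → χ y = 0)
    (hχ : ∀ y, |χ y| ≤ 1) {x y : EuclideanSpace ℝ (Fin n)} (hx : x ≠ 0) (hy : y ≠ 0)
    (hxy : y ≠ x) :
    ‖x‖ ^ (-β) * |K (x - y) - χ (‖x‖⁻¹ • y) * K x| ≤
      C₀ * (2 ^ (n - lam) + (2 ^ β + 4 ^ (-β)) + 4) * weightedKernel lam α β x y * ‖y‖ ^ α := by
  have ha : 0 < ‖x‖ := norm_pos_iff.2 hx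
  have hb : 0 < ‖y‖ := norm_pos_iff.2 hy
  have hk := weightedKernel_nonneg lam α β x y
  have hnorm : ‖‖x‖⁻¹ • y‖ = ‖y‖ / ‖x‖ := by
    rw [norm_smul, norm_inv, norm_norm, inv_mul_eq_div]
  set A : ℝ := 2 ^ (n - lam) + (2 ^ β + 4 ^ (-β)) with hA
  have hA0 : 0 < A := by positivity
  by_cases h4 : ‖y‖ ≤ ‖x‖ / 4
  · rw [hχ1 _ (by rw [hnorm, div_le_iff₀ ha]; linarith), one_mul]
    calc ‖x‖ ^ (-β) * |K (x - y) - K x|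
        ≤ ‖x‖ ^ (-β) * (C₀ * ‖y‖ / ‖x‖ ^ ((n : ℝ) + 1 - lam)) := by
          gcongr
          exact hK2 x y hx (by linarith)
      _ = C₀ * (‖x‖ ^ (lam - n - 1 - β) * ‖y‖) := by
          rw [div_eq_mul_inv, ← Real.rpow_neg ha.le,
            show lam - n - 1 - β = -β + -((n : ℝ) + 1 - lam) by ring, Real.rpow_add ha]
          ring
      _ ≤ C₀ * (weightedKernel lam α β x y * ‖y‖ ^ α) := by
          refine mul_le_mul_of_nonneg_left ?_ (by positivity)
          exact norm_rpow_mul_norm_le_weightedKernel (x := x) hy (by linarith)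
      _ = C₀ * 1 * weightedKernel lam α β x y * ‖y‖ ^ α := by ring
      _ ≤ _ := by
          gcongr
          linarith
  · have hnear : ‖x‖ ^ (-β) * |K (x - y)| ≤ C₀ * A * weightedKernel lam α β x y * ‖y‖ ^ α := by
      calc ‖x‖ ^ (-β) * |K (x - y)| ≤ ‖x‖ ^ (-β) * (C₀ * ‖x - y‖ ^ (lam - n)) := by
            gcongr
            exact hK1 _ (sub_ne_zero.2 hxy.symm)
        _ = C₀ * (‖x‖ ^ (-β) * ‖x - y‖ ^ (lam - n)) := by ring
        _ ≤ C₀ * (A * weightedKernel lam α β x y * ‖y‖ ^ α) := by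
            refine mul_le_mul_of_nonneg_left ?_ hC₀.le
            exact norm_rpow_mul_norm_sub_rpow_le_weightedKernel hln hx hy (by linarith)
        _ = _ := by ring
    have hcut : ‖x‖ ^ (-β) * |χ (‖x‖⁻¹ • y) * K x| ≤
        C₀ * 4 * weightedKernel lam α β x y * ‖y‖ ^ α := by
      by_cases h2 : 2 * ‖y‖ ≤ ‖x‖
      · calc ‖x‖ ^ (-β) * |χ (‖x‖⁻¹ • y) * K x| ≤ ‖x‖ ^ (-β) * (1 * (C₀ * ‖x‖ ^ (lam - n))) := by
              rw [abs_mul]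
              gcongr
              · exact hχ _
              · exact hK1 x hx
          _ = C₀ * (‖x‖ ^ (lam - n - 1 - β) * ‖x‖) := by
              have : ‖x‖ ^ (lam - n - 1 - β) * ‖x‖ = ‖x‖ ^ (-β) * ‖x‖ ^ (lam - n) := by
                rw [← Real.rpow_add ha, ← Real.rpow_add_one ha.ne']
                congr 1
                ring
              rw [this]
              ring
          _ ≤ C₀ * (‖x‖ ^ (lam - n - 1 - β) * (4 * ‖y‖)) := by
              gcongr
              linarith
          _ = C₀ * 4 * (‖x‖ ^ (lam - n - 1 - β) * ‖y‖) := by ring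
          _ ≤ C₀ * 4 * (weightedKernel lam α β x y * ‖y‖ ^ α) := by
              refine mul_le_mul_of_nonneg_left ?_ (by positivity)
              exact norm_rpow_mul_norm_le_weightedKernel (x := x) hy h2
          _ = _ := by ring
      · rw [hχ0 _ (by rw [hnorm, lt_div_iff₀ ha]; linarith)]
        simp only [zero_mul, abs_zero, mul_zero]
        positivity
    calc ‖x‖ ^ (-β) * |K (x - y) - χ (‖x‖⁻¹ • y) * K x|
        ≤ ‖x‖ ^ (-β) * (|K (x - y)| + |χ (‖x‖⁻¹ • y) * K x|) := by
          gcongr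
          exact abs_sub _ _
      _ ≤ C₀ * A * weightedKernel lam α β x y * ‖y‖ ^ α +
          C₀ * 4 * weightedKernel lam α β x y * ‖y‖ ^ α := by
          rw [mul_add]
          exact add_le_add hnear hcut
      _ = _ := by ring

/-- Pointwise domination of the weighted convolution of a divergence-free field by the integral
operator with kernel `weightedKernel`. -/
theorem exists_weighted_convolution_le {n : ℕ} (hn : 2 ≤ n) {lam : ℝ} (α β : ℝ) {C₀ : ℝ}
    (hln : lam < n) (hC₀ : 0 < C₀) {K : EuclideanSpace ℝ (Fin n) → ℝ}
    (hK1 : ∀ x : EuclideanSpace ℝ (Fin n), x ≠ 0 → |K x| ≤ C₀ * ‖x‖ ^ (lam - n))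
    (hK2 : ∀ x y : EuclideanSpace ℝ (Fin n), x ≠ 0 → ‖y‖ ≤ ‖x‖ / 2 →
      |K (x - y) - K x| ≤ C₀ * ‖y‖ / ‖x‖ ^ ((n : ℝ) + 1 - lam)) :
    ∃ A : ℝ, 0 ≤ A ∧ ∀ f : EuclideanSpace ℝ (Fin n) → EuclideanSpace ℝ (Fin n),
      Integrable f →
      (∀ φ : EuclideanSpace ℝ (Fin n) → ℝ, ContDiff ℝ (⊤ : ℕ∞) φ → HasCompactSupport φ →
        ∫ y, ∑ i, f y i * fderiv ℝ φ y (EuclideanSpace.single i 1) = 0) →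
      ∀ x : EuclideanSpace ℝ (Fin n), x ≠ 0 →
        ENNReal.ofReal (‖x‖ ^ (-β) * ‖∫ y, K (x - y) • f y‖) ≤
          ENNReal.ofReal A * ∫⁻ y, ENNReal.ofReal (weightedKernel lam α β x y) *
            ENNReal.ofReal (‖y‖ ^ α * ‖f y‖) := by
  have : Nonempty (Fin n) := ⟨⟨0, by omega⟩⟩
  obtain ⟨χ, C, hC, hχm, hχ1, hχ0, hχ, hdivχ⟩ := exists_cutoff_enorm_integral_le n
  set A₁ : ℝ := C₀ * (2 ^ (n - lam) + (2 ^ β + 4 ^ (-β)) + 4) with hA₁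
  have hA₁0 : 0 ≤ A₁ := by positivity
  refine ⟨A₁ + C₀ * C, by positivity, fun f hf hdiv x hx => ?_⟩
  by_cases hint : Integrable fun y => K (x - y) • f y
  swap
  · simp [integral_undef hint]
  have ha : 0 < ‖x‖ := norm_pos_iff.2 hx
  have hχf : Integrable (fun y => χ (‖x‖⁻¹ • y) • f y) :=
    hf.bdd_smul 1 (hχm.comp (measurable_const_smul _)).aestronglyMeasurable
      (Filter.Eventually.of_forall fun y => hχ _)
  have hKχf : Integrable (fun y => K x • χ (‖x‖⁻¹ • y) • f y) := hχf.smul (K x)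
  have hsplit : ∫ y, K (x - y) • f y =
      (∫ y, (K (x - y) - χ (‖x‖⁻¹ • y) * K x) • f y) + K x • ∫ y, χ (‖x‖⁻¹ • y) • f y := by
    rw [← integral_smul, ← integral_add _ hKχf]
    · congr 1
      funext y
      module
    · refine (hint.sub hKχf).congr (Filter.Eventually.of_forall fun y => ?_)
      simp only [Pi.sub_apply]
      module
  set I : ENNReal := ∫⁻ y, ENNReal.ofReal (weightedKernel lam α β x y) *
    ENNReal.ofReal (‖y‖ ^ α * ‖f y‖) with hI
  have hrem : ENNReal.ofReal (‖x‖ ^ (-β)) *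
      ‖∫ y, (K (x - y) - χ (‖x‖⁻¹ • y) * K x) • f y‖ₑ ≤ ENNReal.ofReal A₁ * I := by
    calc _ ≤ ENNReal.ofReal (‖x‖ ^ (-β)) *
          ∫⁻ y, ‖(K (x - y) - χ (‖x‖⁻¹ • y) * K x) • f y‖ₑ := by
          gcongr
          exact enorm_integral_le_lintegral_enorm _
      _ ≤ _ := by
          rw [hI, ← lintegral_const_mul' _ _ ENNReal.ofReal_ne_top,
            ← lintegral_const_mul' _ _ ENNReal.ofReal_ne_top]
          refine lintegral_mono_ae ?_
          filter_upwards [Measure.ae_ne volume 0, Measure.ae_ne volume x] with y hy hyx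
          rw [← ofReal_norm, norm_smul, Real.norm_eq_abs,
            ← ENNReal.ofReal_mul (by positivity),
            ← ENNReal.ofReal_mul (weightedKernel_nonneg lam α β x y), ← ENNReal.ofReal_mul hA₁0]
          refine ENNReal.ofReal_le_ofReal ?_
          have := mul_le_mul_of_nonneg_right (norm_rpow_mul_abs_sub_cutoff_le (α := α) (β := β)
            hln hC₀ hK1 hK2 hχ1 hχ0 hχ hx hy hyx) (norm_nonneg (f y))
          rw [← hA₁] at this
          linarith
  have hmain : ENNReal.ofReal (‖x‖ ^ (-β)) * ‖K x • ∫ y, χ (‖x‖⁻¹ • y) • f y‖ₑ ≤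
      ENNReal.ofReal (C₀ * C) * I := by
    calc _ ≤ ENNReal.ofReal (‖x‖ ^ (-β)) * (ENNReal.ofReal (C₀ * ‖x‖ ^ (lam - n)) *
          ∫⁻ y, ENNReal.ofReal (if 2 * ‖y‖ ≤ ‖x‖ then C * (‖y‖ / ‖x‖) * ‖f y‖ else 0)) := by
          rw [enorm_smul]
          gcongr
          · rw [← ofReal_norm]
            exact ENNReal.ofReal_le_ofReal (hK1 x hx)
          · exact hdivχ f hf hdiv ‖x‖ ha
      _ ≤ _ := by
          rw [hI, ← lintegral_const_mul' _ _ ENNReal.ofReal_ne_top,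
            ← lintegral_const_mul' _ _ ENNReal.ofReal_ne_top,
            ← lintegral_const_mul' _ _ ENNReal.ofReal_ne_top]
          refine lintegral_mono_ae ?_
          filter_upwards [Measure.ae_ne volume 0] with y hy
          split_ifs with h
          · rw [← ENNReal.ofReal_mul (by positivity), ← ENNReal.ofReal_mul (by positivity),
              ← ENNReal.ofReal_mul (weightedKernel_nonneg lam α β x y),
              ← ENNReal.ofReal_mul (by positivity)]
            refine ENNReal.ofReal_le_ofReal ?_
            have hfar := norm_rpow_mul_norm_le_weightedKernel (lam := lam) (α := α) (β := β) hy h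
            have hpow : ‖x‖ ^ (lam - n - 1 - β) = ‖x‖ ^ (-β) * ‖x‖ ^ (lam - n) / ‖x‖ := by
              rw [← Real.rpow_add ha, ← Real.rpow_sub_one ha.ne']
              congr 1
              ring
            calc ‖x‖ ^ (-β) * (C₀ * ‖x‖ ^ (lam - n) * (C * (‖y‖ / ‖x‖) * ‖f y‖))
                = C₀ * C * (‖x‖ ^ (lam - n - 1 - β) * ‖y‖ * ‖f y‖) := by
                  rw [hpow]
                  ring
              _ ≤ C₀ * C * (weightedKernel lam α β x y * ‖y‖ ^ α * ‖f y‖) := by gcongr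
              _ = _ := by ring
          · simp
  calc ENNReal.ofReal (‖x‖ ^ (-β) * ‖∫ y, K (x - y) • f y‖)
      = ENNReal.ofReal (‖x‖ ^ (-β)) * ‖∫ y, K (x - y) • f y‖ₑ := by
        rw [ENNReal.ofReal_mul (by positivity), ofReal_norm]
    _ ≤ ENNReal.ofReal A₁ * I + ENNReal.ofReal (C₀ * C) * I := by
        rw [hsplit]
        refine (mul_le_mul_right (enorm_add_le _ _) _).trans ?_
        rw [mul_add]
        exact add_le_add hrem hmain
    _ = ENNReal.ofReal (A₁ + C₀ * C) * I := by
        rw [ENNReal.ofReal_add hA₁0 (by positivity), add_mul]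

theorem stmt12 {n : ℕ} (hn : 2 ≤ n) (lam α β q C₀ : ℝ) (hl0 : 0 < lam) (hln : lam < n)
    (hα : α < 1) (hq1 : 1 ≤ q) (hβ : β < n / q) (hαβ : 0 < α + β)
    (hscal : 1 / q = 1 + (α + β - lam) / n) (hC₀ : 0 < C₀)
    (K : EuclideanSpace ℝ (Fin n) → ℝ)
    (hK1 : ∀ x : EuclideanSpace ℝ (Fin n), x ≠ 0 → |K x| ≤ C₀ * ‖x‖ ^ (lam - n))
    (hK2 : ∀ x y : EuclideanSpace ℝ (Fin n), x ≠ 0 → ‖y‖ ≤ ‖x‖ / 2 →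
      |K (x - y) - K x| ≤ C₀ * ‖y‖ / ‖x‖ ^ ((n : ℝ) + 1 - lam)) :
    ∃ C > (0 : ℝ), ∀ f : EuclideanSpace ℝ (Fin n) → EuclideanSpace ℝ (Fin n),
      Integrable f →
      (∀ φ : EuclideanSpace ℝ (Fin n) → ℝ, ContDiff ℝ (⊤ : ℕ∞) φ → HasCompactSupport φ →
        ∫ y, ∑ i, f y i * fderiv ℝ φ y (EuclideanSpace.single i 1) = 0) →
      Integrable (fun x => ‖x‖ ^ α * ‖f x‖) →
      (∫⁻ x, ENNReal.ofReal ((‖x‖ ^ (-β) * ‖∫ y, K (x - y) • f y‖) ^ q)) ^ (1 / q) ≤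
        ENNReal.ofReal (C * ∫ x, ‖x‖ ^ α * ‖f x‖) := by
  have : Nonempty (Fin n) := ⟨⟨0, by omega⟩⟩
  have hq : 0 < q := by linarith
  obtain ⟨A, hA, hdom⟩ := exists_weighted_convolution_le hn α β hln hC₀ hK1 hK2
  obtain ⟨B, hB, hker⟩ := exists_lintegral_weightedKernel_le hn hα hq1 hβ hαβ hscal
  refine ⟨A * B ^ (1 / q) + 1, by positivity, fun f hf hdiv hw => ?_⟩
  have hw0 : ∀ y : EuclideanSpace ℝ (Fin n), 0 ≤ ‖y‖ ^ α * ‖f y‖ := fun y => by positivity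
  calc (∫⁻ x, ENNReal.ofReal ((‖x‖ ^ (-β) * ‖∫ y, K (x - y) • f y‖) ^ q)) ^ (1 / q)
      ≤ (∫⁻ x, ENNReal.ofReal A ^ q * (∫⁻ y, ENNReal.ofReal (weightedKernel lam α β x y) *
          ENNReal.ofReal (‖y‖ ^ α * ‖f y‖)) ^ q) ^ (1 / q) := by
        gcongr ?_ ^ _
        refine lintegral_mono_ae ?_
        filter_upwards [Measure.ae_ne volume 0] with x hx
        rw [← ENNReal.ofReal_rpow_of_nonneg (by positivity) hq.le,
          ← ENNReal.mul_rpow_of_nonneg _ _ hq.le]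
        gcongr
        exact hdom f hf hdiv x hx
    _ = ENNReal.ofReal A * (∫⁻ x, (∫⁻ y, ENNReal.ofReal (weightedKernel lam α β x y) *
          ENNReal.ofReal (‖y‖ ^ α * ‖f y‖)) ^ q) ^ (1 / q) := by
        rw [lintegral_const_mul' _ _ (ENNReal.rpow_ne_top_of_nonneg hq.le ENNReal.ofReal_ne_top),
          ENNReal.mul_rpow_of_nonneg _ _ (by positivity), ← ENNReal.rpow_mul,
          mul_one_div_cancel hq.ne', ENNReal.rpow_one]
    _ ≤ ENNReal.ofReal A * (ENNReal.ofReal B ^ (1 / q) *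
          ∫⁻ y, ENNReal.ofReal (‖y‖ ^ α * ‖f y‖)) := by
        gcongr
        refine lintegral_rpow_lintegral_kernel_le hq1
          (measurable_weightedKernel lam α β).ennreal_ofReal hw.1.aemeasurable.ennreal_ofReal ?_
        filter_upwards [Measure.ae_ne volume 0] with y hy using hker y hy
    _ = ENNReal.ofReal (A * B ^ (1 / q) * ∫ x, ‖x‖ ^ α * ‖f x‖) := by
        rw [← ofReal_integral_eq_lintegral_ofReal hw (Filter.Eventually.of_forall hw0),
          ENNReal.ofReal_rpow_of_nonneg hB (by positivity), ← ENNReal.ofReal_mul (by positivity),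
          ← ENNReal.ofReal_mul hA, mul_assoc]
    _ ≤ _ := by
        refine ENNReal.ofReal_le_ofReal ?_
        have : 0 ≤ ∫ x, ‖x‖ ^ α * ‖f x‖ := integral_nonneg hw0
        gcongr
        linarith
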